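/- arXiv:1109.4222 — 5 statements merged into one kernel-verified Lean document; each statement's English description precedes it below -/
import Mathlib

section
/- For every algebraic curvature tensor R on ℝ⁴, the quadratic curvature identity holds: for all i, j ∈ {1,2,3,4}, (1/4)(|R|² − 4|ρ|² + τ²)δ_{ij} − (Φ₄)_{ij} + 2(Φ₅)_{ij} + (Φ₆)_{ij} − τρ_{ij} = 0; equivalently (1/4)Φ₁ − Φ₂ + (1/4)Φ₃ − Φ₄ + 2Φ₅ + Φ₆ − Φ₇ = 0. -/
/- An algebraic curvature tensor on ℝ⁴ and its quadratic invariants. -/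

noncomputable section

/-- The Ricci tensor `ρ_{ij} = Σ_a R_{iaaj}`. -/
def ricci (R : Fin 4 → Fin 4 → Fin 4 → Fin 4 → ℝ) (i j : Fin 4) : ℝ :=
  ∑ a : Fin 4, R i a a j

/-- The scalar curvature `τ = Σ_a ρ_{aa}`. -/
def scal (R : Fin 4 → Fin 4 → Fin 4 → Fin 4 → ℝ) : ℝ :=
  ∑ a : Fin 4, ricci R a a

/-- `|R|² = Σ R_{ijkl}²`. -/
def normR2 (R : Fin 4 → Fin 4 → Fin 4 → Fin 4 → ℝ) : ℝ :=
  ∑ i : Fin 4, ∑ j : Fin 4, ∑ k : Fin 4, ∑ l : Fin 4, (R i j k l) ^ 2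

/-- `|ρ|² = Σ ρ_{ij}²`. -/
def normRic2 (R : Fin 4 → Fin 4 → Fin 4 → Fin 4 → ℝ) : ℝ :=
  ∑ i : Fin 4, ∑ j : Fin 4, (ricci R i j) ^ 2

/-- The Kronecker delta `δ_{ij}`. -/
def kdelta (i j : Fin 4) : ℝ := if i = j then 1 else 0

/-- `R` is an algebraic curvature tensor: antisymmetry in the first and last pairs,
pair-interchange symmetry, and the first Bianchi identity. -/
def IsACT (R : Fin 4 → Fin 4 → Fin 4 → Fin 4 → ℝ) : Prop :=
  (∀ i j k l, R i j k l = - R j i k l) ∧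
  (∀ i j k l, R i j k l = - R i j l k) ∧
  (∀ i j k l, R i j k l = R k l i j) ∧
  (∀ i j k l, R i j k l + R j k i l + R k i j l = 0)

def Phi1 (R : Fin 4 → Fin 4 → Fin 4 → Fin 4 → ℝ) (i j : Fin 4) : ℝ :=
  normR2 R * kdelta i j

def Phi2 (R : Fin 4 → Fin 4 → Fin 4 → Fin 4 → ℝ) (i j : Fin 4) : ℝ :=
  normRic2 R * kdelta i j

def Phi3 (R : Fin 4 → Fin 4 → Fin 4 → Fin 4 → ℝ) (i j : Fin 4) : ℝ :=
  (scal R) ^ 2 * kdelta i j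

def Phi4 (R : Fin 4 → Fin 4 → Fin 4 → Fin 4 → ℝ) (i j : Fin 4) : ℝ :=
  ∑ a : Fin 4, ∑ b : Fin 4, ∑ c : Fin 4, R a b c i * R a b c j

def Phi5 (R : Fin 4 → Fin 4 → Fin 4 → Fin 4 → ℝ) (i j : Fin 4) : ℝ :=
  ∑ a : Fin 4, ricci R i a * ricci R a j

def Phi6 (R : Fin 4 → Fin 4 → Fin 4 → Fin 4 → ℝ) (i j : Fin 4) : ℝ :=
  2 * ∑ a : Fin 4, ∑ b : Fin 4, R i a b j * ricci R a b

def Phi7 (R : Fin 4 → Fin 4 → Fin 4 → Fin 4 → ℝ) (i j : Fin 4) : ℝ :=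
  scal R * ricci R i j

/-- The curvature identity in dimension four. After reduction to the independent components
of the curvature tensor, it is a polynomial identity in those components. -/
theorem IsACT.quadratic_identity {R : Fin 4 → Fin 4 → Fin 4 → Fin 4 → ℝ} (hR : IsACT R)
    (i j : Fin 4) :
    (1 / 4) * (normR2 R - 4 * normRic2 R + (scal R) ^ 2) * kdelta i j
        - Phi4 R i j + 2 * Phi5 R i j + Phi6 R i j - scal R * ricci R i j = 0 := by
  obtain ⟨antiFst, antiSnd, pair, bianchi⟩ := hR
  have diagFst (i k l) : R i i k l = 0 := by linarith [antiFst i i k l]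
  have diagSnd (i j k) : R i j k k = 0 := by linarith [antiSnd i j k k]
  have cyclic : R 0 3 1 2 = R 0 2 1 3 - R 0 1 2 3 := by
    linarith [bianchi 0 1 2 3, antiFst 2 0 1 3, pair 1 2 0 3]
  fin_cases i <;> fin_cases j <;>
  · simp only [normR2, normRic2, scal, Phi4, Phi5, Phi6, ricci, kdelta, Fin.sum_univ_four,
      Fin.zero_eta, Fin.mk_one, Fin.reduceFinMk, Fin.reduceEq, if_true, if_false,
      diagFst, diagSnd,
      antiFst 1 0, antiFst 2 0, antiFst 3 0, antiFst 2 1, antiFst 3 1, antiFst 3 2,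
      antiSnd _ _ 1 0, antiSnd _ _ 2 0, antiSnd _ _ 3 0,
      antiSnd _ _ 2 1, antiSnd _ _ 3 1, antiSnd _ _ 3 2,
      pair 0 2 0 1, pair 0 3 0 1, pair 1 2 0 1, pair 1 3 0 1, pair 2 3 0 1,
      pair 0 3 0 2, pair 1 2 0 2, pair 1 3 0 2, pair 2 3 0 2,
      pair 1 2 0 3, pair 1 3 0 3, pair 2 3 0 3,
      pair 1 3 1 2, pair 2 3 1 2, pair 2 3 1 3, cyclic]
    ring

/-- For every algebraic curvature tensor `R` on `ℝ⁴`, the quadratic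
curvature identity
`(1/4)(|R|² − 4|ρ|² + τ²)δ_{ij} − (Φ₄)_{ij} + 2(Φ₅)_{ij} + (Φ₆)_{ij} − τρ_{ij} = 0`
holds; equivalently `(1/4)Φ₁ − Φ₂ + (1/4)Φ₃ − Φ₄ + 2Φ₅ + Φ₆ − Φ₇ = 0`. -/
theorem universal_curvature_identity_dim4
    (R : Fin 4 → Fin 4 → Fin 4 → Fin 4 → ℝ) (hR : IsACT R) (i j : Fin 4) :
    (1 / 4) * (normR2 R - 4 * normRic2 R + (scal R) ^ 2) * kdelta i j
        - Phi4 R i j + 2 * Phi5 R i j + Phi6 R i j - scal R * ricci R i j = 0 ∧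
    (1 / 4) * Phi1 R i j - Phi2 R i j + (1 / 4) * Phi3 R i j
        - Phi4 R i j + 2 * Phi5 R i j + Phi6 R i j - Phi7 R i j = 0 := by
  have h := hR.quadratic_identity i j
  refine ⟨h, ?_⟩
  unfold Phi1 Phi2 Phi3 Phi7
  linear_combination h
end
end

section
/- Let (c₁,…,c₇) ∈ ℝ⁷ and set λ = −c₇. If Σ_{i=1}^{7} cᵢΦᵢ(R) = 0 holds for every tensor R in the four test families R^I(a,b), R^{II}(a), R^{III}(a), R^{IV}(a) (for all real a, b with a ≠ 0, b ≠ 0 where relevant), then (c₁,…,c₇) = λ·(1/4, −1, 1/4, −1, 2, 1, −1). -/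
/- An algebraic curvature tensor on ℝ⁴ and its quadratic invariants. -/

noncomputable section

/-- Indicator of the index block `{1,2}` (zero-based `{0,1}`). -/
def ind12 (i : Fin 4) : ℝ := if i = 0 ∨ i = 1 then 1 else 0

/-- Indicator of the index block `{3,4}` (zero-based `{2,3}`). -/
def ind34 (i : Fin 4) : ℝ := if i = 2 ∨ i = 3 then 1 else 0

/-- Indicator of the index block `{1,2,3}` (zero-based `{0,1,2}`). -/
def ind123 (i : Fin 4) : ℝ := if i = 3 then 0 else 1

/-- Test family I: the only nonzero components are `R_{1212} = a` and `R_{3434} = b`,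
together with the components forced by the symmetries (product of two surfaces of
constant Gaussian curvatures `a` and `b`). -/
def RI (a b : ℝ) (i j k l : Fin 4) : ℝ :=
  a * ind12 i * ind12 j * ind12 k * ind12 l *
      (kdelta i k * kdelta j l - kdelta i l * kdelta j k)
  + b * ind34 i * ind34 j * ind34 k * ind34 l *
      (kdelta i k * kdelta j l - kdelta i l * kdelta j k)

/-- Test family II: `R_{ijkl} = a(δ_{ik}δ_{jl} − δ_{il}δ_{jk})` when `i,j,k,l ∈ {1,2,3}`,
and every component with some index equal to `4` is zero (`M³(a) × ℝ`). -/
def RII (a : ℝ) (i j k l : Fin 4) : ℝ :=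
  a * ind123 i * ind123 j * ind123 k * ind123 l *
    (kdelta i k * kdelta j l - kdelta i l * kdelta j k)

/-- Test family III: `R_{ijkl} = a(δ_{ik}δ_{jl} − δ_{il}δ_{jk})` (a 4-dimensional
space form of constant sectional curvature `a`). -/
def RIII (a : ℝ) (i j k l : Fin 4) : ℝ :=
  a * (kdelta i k * kdelta j l - kdelta i l * kdelta j k)

/-- The pair coefficients of test family IV: `−a²` on the pairs `{2,3}` and `{2,4}`
(zero-based `{1,2}` and `{1,3}`), and `a²` on the other pairs. -/
def cIV (a : ℝ) (i j : Fin 4) : ℝ :=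
  if (i = 1 ∧ j = 2) ∨ (i = 2 ∧ j = 1) ∨ (i = 1 ∧ j = 3) ∨ (i = 3 ∧ j = 1) then
    -(a ^ 2)
  else a ^ 2

/-- Test family IV: the only nonzero components are
`R_{1212} = R_{1313} = R_{1414} = R_{3434} = a²` and `R_{2323} = R_{2424} = −a²`,
together with the components forced by the symmetries (solvable Lie group). -/
def RIV (a : ℝ) (i j k l : Fin 4) : ℝ :=
  cIV a i j * (kdelta i k * kdelta j l - kdelta i l * kdelta j k)

/-- If `Σ cᵢΦᵢ(R) = 0` holds for every tensor in the four test
families `R^I(a,b)`, `R^{II}(a)`, `R^{III}(a)`, `R^{IV}(a)` (for all nonzero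
parameters), then `(c₁,…,c₇) = λ·(1/4, −1, 1/4, −1, 2, 1, −1)` with `λ = −c₇`. -/
theorem coefficients_determined_by_test_families
    (c₁ c₂ c₃ c₄ c₅ c₆ c₇ lam : ℝ) (hlam : lam = -c₇)
    (hI : ∀ a b : ℝ, a ≠ 0 → b ≠ 0 → ∀ i j : Fin 4,
        c₁ * Phi1 (RI a b) i j + c₂ * Phi2 (RI a b) i j + c₃ * Phi3 (RI a b) i j
          + c₄ * Phi4 (RI a b) i j + c₅ * Phi5 (RI a b) i j + c₆ * Phi6 (RI a b) i j
          + c₇ * Phi7 (RI a b) i j = 0)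
    (hII : ∀ a : ℝ, a ≠ 0 → ∀ i j : Fin 4,
        c₁ * Phi1 (RII a) i j + c₂ * Phi2 (RII a) i j + c₃ * Phi3 (RII a) i j
          + c₄ * Phi4 (RII a) i j + c₅ * Phi5 (RII a) i j + c₆ * Phi6 (RII a) i j
          + c₇ * Phi7 (RII a) i j = 0)
    (hIII : ∀ a : ℝ, a ≠ 0 → ∀ i j : Fin 4,
        c₁ * Phi1 (RIII a) i j + c₂ * Phi2 (RIII a) i j + c₃ * Phi3 (RIII a) i j
          + c₄ * Phi4 (RIII a) i j + c₅ * Phi5 (RIII a) i j + c₆ * Phi6 (RIII a) i j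
          + c₇ * Phi7 (RIII a) i j = 0)
    (hIV : ∀ a : ℝ, a ≠ 0 → ∀ i j : Fin 4,
        c₁ * Phi1 (RIV a) i j + c₂ * Phi2 (RIV a) i j + c₃ * Phi3 (RIV a) i j
          + c₄ * Phi4 (RIV a) i j + c₅ * Phi5 (RIV a) i j + c₆ * Phi6 (RIV a) i j
          + c₇ * Phi7 (RIV a) i j = 0) :
    c₁ = lam * (1 / 4) ∧ c₂ = lam * (-1) ∧ c₃ = lam * (1 / 4) ∧ c₄ = lam * (-1) ∧
      c₅ = lam * 2 ∧ c₆ = lam * 1 ∧ c₇ = lam * (-1) := by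
  have e1 := hI 1 1 one_ne_zero one_ne_zero 0 0
  have e2 := hI 1 (-1) one_ne_zero (by norm_num) 0 0
  have e3 := hI 1 2 one_ne_zero two_ne_zero 0 0
  have e4 := hII 1 one_ne_zero 0 0
  have e5 := hII 1 one_ne_zero 3 3
  have e6 := hIII 1 one_ne_zero 0 0
  have e7 := hIV 1 one_ne_zero 0 0
  have e8 := hIV 1 one_ne_zero 1 1
  have e9 := hIV 1 one_ne_zero 2 2
  simp [Phi1, Phi2, Phi3, Phi4, Phi5, Phi6, Phi7, normR2, normRic2, scal, ricci, RI, RII, RIII,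
    RIV, cIV, ind12, ind34, ind123, kdelta, Fin.sum_univ_four] at e1 e2 e3 e4 e5 e6 e7 e8 e9
  norm_num at e1 e2 e3 e4 e5 e6 e7 e8 e9
  subst hlam
  refine ⟨?_, ?_, ?_, ?_, ?_, ?_, ?_⟩ <;> linarith
end
end

section
/- Fix a, b ∈ ℝ with a ≠ 0. The skew-symmetric bilinear bracket on ℝ⁴ defined on the standard orthonormal basis by [e₁,e₂] = a e₂, [e₁,e₃] = −a e₃ − b e₄, [e₁,e₄] = b e₃ − a e₄, [e₂,e₃] = [e₂,e₄] = [e₃,e₄] = 0 satisfies the Jacobi identity. Moreover, if ∇ is the bilinear map on ℝ⁴ determined by the Koszul formula ⟨∇ₓy, z⟩ = ½(⟨[x,y], z⟩ − ⟨[y,z], x⟩ + ⟨[z,x], y⟩) with respect to the standard inner product, then the tensor R_{ijkl} := ⟨∇_{e_i}∇_{e_j}e_k − ∇_{e_j}∇_{e_i}e_k − ∇_{[e_i,e_j]}e_k, e_l⟩ has nonzero components exactly R_{1212} = R_{1313} = R_{1414} = R_{3434} = a², R_{2323} = R_{2424} = −a² (up to the curvature symmetries), its Ricci tensor ρ_{ij}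 = Σ_a R_{iaaj} equals diag(−3a², a², −a², −a²), and its scalar curvature is τ = −4a². -/
noncomputable section

/-- The standard basis vectors of `ℝ⁴`. -/
def e (i : Fin 4) : Fin 4 → ℝ := Pi.single i 1

/-- The standard inner product on `ℝ⁴`. -/
def ip (x y : Fin 4 → ℝ) : ℝ := ∑ i : Fin 4, x i * y i

/-- The bracket on the standard basis: `[e₁,e₂] = a e₂`, `[e₁,e₃] = −a e₃ − b e₄`,
`[e₁,e₄] = b e₃ − a e₄`, `[e₂,e₃] = [e₂,e₄] = [e₃,e₄] = 0` (zero-based indices). -/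
def brkt (a b : ℝ) (i j : Fin 4) : Fin 4 → ℝ :=
  if i = 0 ∧ j = 1 then a • e 1
  else if i = 1 ∧ j = 0 then -(a • e 1)
  else if i = 0 ∧ j = 2 then (-a) • e 2 + (-b) • e 3
  else if i = 2 ∧ j = 0 then -((-a) • e 2 + (-b) • e 3)
  else if i = 0 ∧ j = 3 then b • e 2 + (-a) • e 3
  else if i = 3 ∧ j = 0 then -(b • e 2 + (-a) • e 3)
  else 0

/-- The skew-symmetric bilinear extension of the bracket to all of `ℝ⁴`. -/
def bracket (a b : ℝ) (x y : Fin 4 → ℝ) : Fin 4 → ℝ :=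
  ∑ i : Fin 4, ∑ j : Fin 4, (x i * y j) • brkt a b i j

/-- The Levi-Civita connection determined by the Koszul formula
`⟨∇ₓy, z⟩ = ½(⟨[x,y], z⟩ − ⟨[y,z], x⟩ + ⟨[z,x], y⟩)`. -/
def nabla (a b : ℝ) (x y : Fin 4 → ℝ) : Fin 4 → ℝ := fun k =>
  (1 / 2) * (ip (bracket a b x y) (e k) - ip (bracket a b y (e k)) x
    + ip (bracket a b (e k) x) y)

/-- The curvature tensor
`R_{ijkl} = ⟨∇_{e_i}∇_{e_j}e_k − ∇_{e_j}∇_{e_i}e_k − ∇_{[e_i,e_j]}e_k, e_l⟩`. -/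
def Rcurv (a b : ℝ) (i j k l : Fin 4) : ℝ :=
  ip (nabla a b (e i) (nabla a b (e j) (e k)) - nabla a b (e j) (nabla a b (e i) (e k))
      - nabla a b (bracket a b (e i) (e j)) (e k)) (e l)

/-- The Ricci tensor `ρ_{ij} = Σ_a R_{iaaj}` of `Rcurv`. -/
def ricciCurv (a b : ℝ) (i j : Fin 4) : ℝ := ∑ c : Fin 4, Rcurv a b i c c j

/-- The expected curvature components: `R_{1212} = R_{1313} = R_{1414} = R_{3434} = a²`,
`R_{2323} = R_{2424} = −a²`, and the components forced by the symmetries. -/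
def RIVexp (a : ℝ) (i j k l : Fin 4) : ℝ :=
  (if (i = 1 ∧ j = 2) ∨ (i = 2 ∧ j = 1) ∨ (i = 1 ∧ j = 3) ∨ (i = 3 ∧ j = 1) then
      -(a ^ 2)
    else a ^ 2) *
    (kdelta i k * kdelta j l - kdelta i l * kdelta j k)

theorem bracket_eq (a b : ℝ) (x y : Fin 4 → ℝ) :
    bracket a b x y =
      ![0, a * (x 0 * y 1 - x 1 * y 0),
        -a * (x 0 * y 2 - x 2 * y 0) + b * (x 0 * y 3 - x 3 * y 0),
        -b * (x 0 * y 2 - x 2 * y 0) - a * (x 0 * y 3 - x 3 * y 0)] := by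
  funext k
  fin_cases k <;> simp [bracket, brkt, e, Fin.sum_univ_four] <;> ring

theorem nabla_eq (a b : ℝ) (x y : Fin 4 → ℝ) :
    nabla a b x y =
      ![a * (x 1 * y 1 - x 2 * y 2 - x 3 * y 3), -a * (x 1 * y 0),
        a * (x 2 * y 0) + b * (x 0 * y 3), a * (x 3 * y 0) - b * (x 0 * y 2)] := by
  funext k
  fin_cases k <;> simp [nabla, bracket_eq, ip, e, Fin.sum_univ_four] <;> ring

theorem bracket_jacobi (a b : ℝ) (x y z : Fin 4 → ℝ) :
    bracket a b x (bracket a b y z) + bracket a b y (bracket a b z x)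
      + bracket a b z (bracket a b x y) = 0 := by
  funext k
  fin_cases k <;> simp [bracket_eq] <;> ring

set_option maxHeartbeats 2000000 in
theorem Rcurv_eq_RIVexp (a b : ℝ) (i j k l : Fin 4) :
    Rcurv a b i j k l = RIVexp a i j k l := by
  fin_cases i <;> fin_cases j <;> fin_cases k <;> fin_cases l <;>
    simp [Rcurv, RIVexp, kdelta, nabla_eq, bracket_eq, ip, e, Fin.sum_univ_four] <;> ring

theorem ricciCurv_eq_diagonal (a b : ℝ) (i j : Fin 4) :
    ricciCurv a b i j =
      Matrix.diagonal ![-3 * a ^ 2, a ^ 2, -a ^ 2, -a ^ 2] i j := by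
  fin_cases i <;> fin_cases j <;>
    simp [ricciCurv, Rcurv_eq_RIVexp, RIVexp, kdelta, Fin.sum_univ_four] <;> ring

/-- The given bracket on `ℝ⁴` satisfies the Jacobi identity; the
associated Koszul curvature tensor has nonzero components exactly
`R_{1212} = R_{1313} = R_{1414} = R_{3434} = a²`, `R_{2323} = R_{2424} = −a²`
(up to the curvature symmetries); its Ricci tensor is `diag(−3a², a², −a², −a²)`;
and its scalar curvature is `τ = −4a²`. -/
theorem solvable_lie_algebra_curvature (a b : ℝ) (ha : a ≠ 0) :
    (∀ x y z : Fin 4 → ℝ,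
        bracket a b x (bracket a b y z) + bracket a b y (bracket a b z x)
          + bracket a b z (bracket a b x y) = 0) ∧
    (∀ i j k l : Fin 4, Rcurv a b i j k l = RIVexp a i j k l) ∧
    (∀ i j : Fin 4, ricciCurv a b i j =
        Matrix.diagonal ![-3 * a ^ 2, a ^ 2, -a ^ 2, -a ^ 2] i j) ∧
    (∑ c : Fin 4, ricciCurv a b c c) = -4 * a ^ 2 := by
  refine ⟨bracket_jacobi a b, Rcurv_eq_RIVexp a b, ricciCurv_eq_diagonal a b, ?_⟩
  simp [ricciCurv_eq_diagonal, Fin.sum_univ_four]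
  ring
end
end

section
/- For all a ∈ ℝ, the tensor R^{IV}(a) is an algebraic curvature tensor on ℝ⁴ and its invariants are: ρ = diag(−3a², a², −a², −a²), τ = −4a², Φ₁ = 24a⁴·Id, Φ₂ = 12a⁴·Id, Φ₃ = 16a⁴·Id, Φ₄ = 6a⁴·Id, Φ₅ = a⁴·diag(9, 1, 1, 1), Φ₆ = 2a⁴·diag(1, 1, 5, 5), and Φ₇ = 4a⁴·diag(3, −1, 1, 1). -/
/- An algebraic curvature tensor on ℝ⁴ and its quadratic invariants. -/

noncomputable section

theorem cIV_comm (a : ℝ) (i j : Fin 4) : cIV a i j = cIV a j i := by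
  fin_cases i <;> fin_cases j <;> simp [cIV]

theorem isACT_RIV (a : ℝ) : IsACT (RIV a) := by
  refine ⟨fun i j k l => ?_, fun i j k l => ?_, fun i j k l => ?_, fun i j k l => ?_⟩
  · rw [RIV, RIV, cIV_comm a j i]
    ring
  · rw [RIV, RIV]
    ring
  · fin_cases i <;> fin_cases j <;> fin_cases k <;> fin_cases l <;>
      simp [RIV, cIV, kdelta]
  · fin_cases i <;> fin_cases j <;> fin_cases k <;> fin_cases l <;>
      simp [RIV, cIV, kdelta]

theorem ricci_RIV (a : ℝ) (i j : Fin 4) :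
    ricci (RIV a) i j =
      Matrix.diagonal ![-3 * a ^ 2, a ^ 2, -a ^ 2, -a ^ 2] i j := by
  fin_cases i <;> fin_cases j <;>
    simp [ricci, RIV, cIV, kdelta, Fin.sum_univ_four] <;> ring

theorem scal_RIV (a : ℝ) : scal (RIV a) = -4 * a ^ 2 := by
  simp only [scal, ricci_RIV, Fin.sum_univ_four, Matrix.diagonal_apply_eq]
  simp
  ring

theorem normR2_RIV (a : ℝ) : normR2 (RIV a) = 24 * a ^ 4 := by
  simp [normR2, RIV, cIV, kdelta, Fin.sum_univ_four]
  ring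

theorem normRic2_RIV (a : ℝ) : normRic2 (RIV a) = 12 * a ^ 4 := by
  simp [normRic2, ricci_RIV, Fin.sum_univ_four, Matrix.diagonal_apply]
  ring

theorem Phi4_RIV (a : ℝ) (i j : Fin 4) :
    Phi4 (RIV a) i j = 6 * a ^ 4 * kdelta i j := by
  fin_cases i <;> fin_cases j <;>
    simp [Phi4, RIV, cIV, kdelta, Fin.sum_univ_four] <;> ring

theorem Phi5_RIV (a : ℝ) (i j : Fin 4) :
    Phi5 (RIV a) i j = a ^ 4 * Matrix.diagonal ![9, 1, 1, 1] i j := by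
  fin_cases i <;> fin_cases j <;>
    simp [Phi5, ricci_RIV, Matrix.diagonal_apply] <;> ring

theorem Phi6_RIV (a : ℝ) (i j : Fin 4) :
    Phi6 (RIV a) i j = 2 * a ^ 4 * Matrix.diagonal ![1, 1, 5, 5] i j := by
  fin_cases i <;> fin_cases j <;>
    simp [Phi6, ricci_RIV, RIV, cIV, kdelta, Fin.sum_univ_four, Matrix.diagonal_apply] <;>
    ring

theorem Phi7_RIV (a : ℝ) (i j : Fin 4) :
    Phi7 (RIV a) i j = 4 * a ^ 4 * Matrix.diagonal ![3, -1, 1, 1] i j := by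
  rw [Phi7, scal_RIV, ricci_RIV]
  fin_cases i <;> fin_cases j <;> simp <;> ring

/-- `R^{IV}(a)` is an algebraic curvature tensor on `ℝ⁴`, with
`ρ = diag(−3a², a², −a², −a²)`, `τ = −4a²`, `Φ₁ = 24a⁴·Id`, `Φ₂ = 12a⁴·Id`,
`Φ₃ = 16a⁴·Id`, `Φ₄ = 6a⁴·Id`, `Φ₅ = a⁴·diag(9,1,1,1)`, `Φ₆ = 2a⁴·diag(1,1,5,5)`,
`Φ₇ = 4a⁴·diag(3,−1,1,1)`. -/
theorem invariants_of_RIV (a : ℝ) :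
    IsACT (RIV a) ∧
    (∀ i j : Fin 4, ricci (RIV a) i j =
        Matrix.diagonal ![-3 * a ^ 2, a ^ 2, -a ^ 2, -a ^ 2] i j) ∧
    scal (RIV a) = -4 * a ^ 2 ∧
    (∀ i j : Fin 4, Phi1 (RIV a) i j = 24 * a ^ 4 * kdelta i j) ∧
    (∀ i j : Fin 4, Phi2 (RIV a) i j = 12 * a ^ 4 * kdelta i j) ∧
    (∀ i j : Fin 4, Phi3 (RIV a) i j = 16 * a ^ 4 * kdelta i j) ∧
    (∀ i j : Fin 4, Phi4 (RIV a) i j = 6 * a ^ 4 * kdelta i j) ∧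
    (∀ i j : Fin 4, Phi5 (RIV a) i j = a ^ 4 * Matrix.diagonal ![9, 1, 1, 1] i j) ∧
    (∀ i j : Fin 4, Phi6 (RIV a) i j = 2 * a ^ 4 * Matrix.diagonal ![1, 1, 5, 5] i j) ∧
    (∀ i j : Fin 4, Phi7 (RIV a) i j =
        4 * a ^ 4 * Matrix.diagonal ![3, -1, 1, 1] i j) := by
  refine ⟨isACT_RIV a, ricci_RIV a, scal_RIV a, fun i j => ?_, fun i j => ?_, fun i j => ?_,
    Phi4_RIV a, Phi5_RIV a, Phi6_RIV a, Phi7_RIV a⟩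
  · rw [Phi1, normR2_RIV]
  · rw [Phi2, normRic2_RIV]
  · rw [Phi3, scal_RIV]
    ring
end
end

section
/- Define σ₁, σ₂, τ : ℝ⁴ → ℝ by σ₁(x) = x₁² + x₂², σ₂(x) = x₃² + x₄², and τ = −8e^{−2σ₁} − 8e^{−2σ₂}. Then at every point of ℝ⁴, e^{−2σ₁}(∂₁²τ + ∂₂²τ) + e^{−2σ₂}(∂₃²τ + ∂₄²τ) = −64(e^{−4σ₁}(2σ₁ − 1) + e^{−4σ₂}(2σ₂ − 1)). -/
open Real

noncomputable section

/-- `σ₁(x) = x₁² + x₂²`. -/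
def sigma1 (x : Fin 4 → ℝ) : ℝ := x 0 ^ 2 + x 1 ^ 2

/-- `σ₂(x) = x₃² + x₄²`. -/
def sigma2 (x : Fin 4 → ℝ) : ℝ := x 2 ^ 2 + x 3 ^ 2

/-- The scalar curvature `τ = −8e^{−2σ₁} − 8e^{−2σ₂}` of the product metric
`g = e^{2σ₁}(dx₁² + dx₂²) + e^{2σ₂}(dx₃² + dx₄²)`. -/
def tau (x : Fin 4 → ℝ) : ℝ :=
  -8 * exp (-2 * sigma1 x) + -8 * exp (-2 * sigma2 x)

/-- The partial derivative `∂ᵢf` of a function on `ℝ⁴`. -/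
def pd (i : Fin 4) (f : (Fin 4 → ℝ) → ℝ) (x : Fin 4 → ℝ) : ℝ :=
  fderiv ℝ f x (Pi.single i 1)

theorem hasFDerivAt_gaussian (i j : Fin 4) (x : Fin 4 → ℝ) :
    HasFDerivAt (fun y : Fin 4 → ℝ => exp (-2 * (y i ^ 2 + y j ^ 2)))
      ((-4 * exp (-2 * (x i ^ 2 + x j ^ 2))) •
        (x i • ContinuousLinearMap.proj (R := ℝ) (φ := fun _ : Fin 4 => ℝ) i +
          x j • ContinuousLinearMap.proj (R := ℝ) (φ := fun _ : Fin 4 => ℝ) j)) x := by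
  have hi := hasFDerivAt_apply (𝕜 := ℝ) (F' := fun _ : Fin 4 => ℝ) i x
  have hj := hasFDerivAt_apply (𝕜 := ℝ) (F' := fun _ : Fin 4 => ℝ) j x
  have h : HasFDerivAt (fun y : Fin 4 → ℝ => exp (-2 * (y i ^ 2 + y j ^ 2))) _ x :=
    (((hi.pow 2).add (hj.pow 2)).const_mul (-2)).exp
  refine h.congr_fderiv (ContinuousLinearMap.ext fun v => ?_)
  simp
  ring

theorem pd_tau (k : Fin 4) (x : Fin 4 → ℝ) :
    pd k tau x =
      32 * exp (-2 * (x 0 ^ 2 + x 1 ^ 2)) *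
          (x 0 * (Pi.single k 1 : Fin 4 → ℝ) 0 + x 1 * (Pi.single k 1 : Fin 4 → ℝ) 1) +
        32 * exp (-2 * (x 2 ^ 2 + x 3 ^ 2)) *
          (x 2 * (Pi.single k 1 : Fin 4 → ℝ) 2 + x 3 * (Pi.single k 1 : Fin 4 → ℝ) 3) := by
  have h : HasFDerivAt tau _ x :=
    ((hasFDerivAt_gaussian 0 1 x).const_mul (-8)).add
      ((hasFDerivAt_gaussian 2 3 x).const_mul (-8))
  rw [pd, h.fderiv]
  simp
  ring

theorem pd_coord_mul_gaussian (k i j : Fin 4) (hk : k = i ∨ k = j) (hij : i ≠ j)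
    (x : Fin 4 → ℝ) :
    pd k (fun y => 32 * exp (-2 * (y i ^ 2 + y j ^ 2)) * y k) x =
      32 * exp (-2 * (x i ^ 2 + x j ^ 2)) * (1 - 4 * x k ^ 2) := by
  have hc := hasFDerivAt_apply (𝕜 := ℝ) (F' := fun _ : Fin 4 => ℝ) k x
  have h : HasFDerivAt (fun y => 32 * exp (-2 * (y i ^ 2 + y j ^ 2)) * y k) _ x :=
    ((hasFDerivAt_gaussian i j x).const_mul 32).mul hc
  rw [pd, h.fderiv]
  rcases hk with rfl | rfl
  · simp [hij.symm]
    ring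
  · simp [hij]
    ring

/-- The Laplace–Beltrami operator of the product metric applied to the
scalar curvature `τ`:
`e^{−2σ₁}(∂₁²τ + ∂₂²τ) + e^{−2σ₂}(∂₃²τ + ∂₄²τ) = −64(e^{−4σ₁}(2σ₁ − 1) + e^{−4σ₂}(2σ₂ − 1))`. -/
theorem laplacian_of_scalar_curvature (x : Fin 4 → ℝ) :
    exp (-2 * sigma1 x) * (pd 0 (pd 0 tau) x + pd 1 (pd 1 tau) x)
      + exp (-2 * sigma2 x) * (pd 2 (pd 2 tau) x + pd 3 (pd 3 tau) x) =
    -64 * (exp (-4 * sigma1 x) * (2 * sigma1 x - 1)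
      + exp (-4 * sigma2 x) * (2 * sigma2 x - 1)) := by
  have h0 : pd 0 tau = fun y => 32 * exp (-2 * (y 0 ^ 2 + y 1 ^ 2)) * y 0 := by
    ext y; simp [pd_tau]
  have h1 : pd 1 tau = fun y => 32 * exp (-2 * (y 0 ^ 2 + y 1 ^ 2)) * y 1 := by
    ext y; simp [pd_tau]
  have h2 : pd 2 tau = fun y => 32 * exp (-2 * (y 2 ^ 2 + y 3 ^ 2)) * y 2 := by
    ext y; simp [pd_tau]
  have h3 : pd 3 tau = fun y => 32 * exp (-2 * (y 2 ^ 2 + y 3 ^ 2)) * y 3 := by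
    ext y; simp [pd_tau]
  have hexp (s : ℝ) : exp (-4 * s) = exp (-2 * s) * exp (-2 * s) := by
    rw [← exp_add]; ring_nf
  rw [h0, h1, h2, h3, pd_coord_mul_gaussian 0 0 1 (by decide) (by decide),
    pd_coord_mul_gaussian 1 0 1 (by decide) (by decide),
    pd_coord_mul_gaussian 2 2 3 (by decide) (by decide),
    pd_coord_mul_gaussian 3 2 3 (by decide) (by decide), hexp, hexp, sigma1, sigma2]
  ring
end
end
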